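/- arXiv:1702.02867 — 2 statements merged into one kernel-verified Lean document; each statement's English description precedes it below -/
import Mathlib

section
/- For real z ≥ 1 and λ = 1: 1/2 - Q(z, z) ~ 1/(3√(2πz)) as z → ∞, where Q(z, x) = Γ(z,x)/Γ(z) is the regularized upper incomplete gamma function. In particular Q(z,z) → 1/2. -/
open Filter Real MeasureTheory

/-- Upper incomplete gamma function. -/
noncomputable def upperGamma (z x : ℝ) : ℝ :=
  ∫ t in Set.Ioi x, t ^ (z - 1) * Real.exp (-t)

/-- Regularized upper incomplete gamma function. -/
noncomputable def regGammaQ (z x : ℝ) : ℝ := upperGamma z x / Real.Gamma z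

/-- The phase function `exp u - 1 - u` of the Gamma integral in logarithmic coordinates. -/
noncomputable def gammaPhase (u : ℝ) : ℝ := Real.exp u - 1 - u

lemma continuous_gammaPhase : Continuous gammaPhase := by
  unfold gammaPhase; fun_prop

lemma abs_gammaPhase_sub_le {u : ℝ} (hu : |u| ≤ 1) :
    |gammaPhase u - u ^ 2 / 2| ≤ |u| ^ 3 * (2 / 9) := by
  have h := Real.exp_bound hu (n := 3) (by norm_num)
  norm_num [Finset.sum_range_succ, Nat.factorial] at h
  convert h using 2
  unfold gammaPhase; ring

lemma abs_gammaPhase_odd_sub_le {u : ℝ} (h0 : 0 ≤ u) (hu : u ≤ 1) :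
    |gammaPhase (-u) - gammaPhase u + u ^ 3 / 3| ≤ u ^ 5 / 50 := by
  have h1 := Real.exp_bound (x := u) (by rwa [abs_of_nonneg h0]) (n := 5) (by norm_num)
  have h2 := Real.exp_bound (x := -u) (by rwa [abs_neg, abs_of_nonneg h0]) (n := 5) (by norm_num)
  rw [abs_neg] at h2
  rw [abs_of_nonneg h0] at h1 h2
  norm_num [Finset.sum_range_succ, Nat.factorial] at h1 h2
  rw [abs_le] at *
  unfold gammaPhase
  constructor <;> linarith [h1.1, h1.2, h2.1, h2.2]

lemma gammaPhase_neg_le {u : ℝ} (h0 : 0 ≤ u) : gammaPhase (-u) ≤ gammaPhase u := by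
  have h := Real.self_le_sinh_iff.2 h0
  rw [Real.sinh_eq] at h
  unfold gammaPhase
  linarith

lemma sq_div_four_le_gammaPhase_neg {u : ℝ} (h0 : 0 ≤ u) (hu : u ≤ 1) :
    u ^ 2 / 4 ≤ gammaPhase (-u) := by
  have h := abs_gammaPhase_sub_le (u := -u) (by rwa [abs_neg, abs_of_nonneg h0])
  rw [abs_neg, abs_of_nonneg h0, abs_le] at h
  nlinarith [h.1, mul_nonneg (sq_nonneg u) (sub_nonneg.2 hu)]

lemma div_four_le_gammaPhase_neg {u : ℝ} (hu : 1 ≤ u) : u / 4 ≤ gammaPhase (-u) := by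
  have h1 : Real.exp (-u) = Real.exp (-1) * Real.exp (-(u - 1)) := by
    rw [← Real.exp_add]; ring_nf
  have h2 := Real.add_one_le_exp (-(u - 1))
  have h3 := Real.exp_neg_one_gt_d9
  have h4 := Real.exp_neg_one_lt_d9
  unfold gammaPhase
  rw [h1]
  nlinarith [mul_le_mul_of_nonneg_left h2 (Real.exp_pos (-1)).le,
    mul_nonneg (sub_nonneg.2 hu) (sub_nonneg.2 h4.le)]

lemma exp_neg_sq_mul_gammaPhase_neg_le {w v : ℝ} (hw : 1 ≤ w) (hv : 0 ≤ v) :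
    Real.exp (-(w ^ 2 * gammaPhase (-(v / w)))) ≤ Real.exp (1 / 4) * Real.exp (-(1 / 4) * v) := by
  have hw0 : 0 < w := by linarith
  rw [← Real.exp_add, Real.exp_le_exp]
  rcases le_total (v / w) 1 with h | h
  · have h1 := mul_le_mul_of_nonneg_left
      (sq_div_four_le_gammaPhase_neg (by positivity) h) (sq_nonneg w)
    have h2 : w ^ 2 * ((v / w) ^ 2 / 4) = v ^ 2 / 4 := by field_simp
    nlinarith [sq_nonneg (v - 1)]
  · have h1 := mul_le_mul_of_nonneg_left (div_four_le_gammaPhase_neg h) (sq_nonneg w)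
    have h2 : w ^ 2 * ((v / w) / 4) = v * w / 4 := by field_simp
    nlinarith

lemma exp_neg_sq_mul_gammaPhase_le {w v : ℝ} (hw : 1 ≤ w) (hv : 0 ≤ v) :
    Real.exp (-(w ^ 2 * gammaPhase (v / w))) ≤ Real.exp (1 / 4) * Real.exp (-(1 / 4) * v) := by
  refine le_trans ?_ (exp_neg_sq_mul_gammaPhase_neg_le hw hv)
  have hw0 : 0 < w := by linarith
  have := gammaPhase_neg_le (u := v / w) (by positivity)
  gcongr

lemma exp_neg_sub_exp_neg_le (a b : ℝ) :
    Real.exp (-a) - Real.exp (-b) ≤ (b - a) * Real.exp (-a) := by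
  have h1 : Real.exp (-b) = Real.exp (-a) * Real.exp (-(b - a)) := by
    rw [← Real.exp_add]; ring_nf
  have h2 := Real.add_one_le_exp (-(b - a))
  nlinarith [mul_le_mul_of_nonneg_left h2 (Real.exp_pos (-a)).le]

lemma mul_exp_neg_le_exp_neg_sub_exp_neg (a b : ℝ) :
    (b - a) * Real.exp (-b) ≤ Real.exp (-a) - Real.exp (-b) := by
  have := exp_neg_sub_exp_neg_le b a
  linarith

lemma exp_gammaPhase_diff_nonneg {w v : ℝ} (hw : 0 < w) (hv : 0 ≤ v) :
    0 ≤ w * (Real.exp (-(w ^ 2 * gammaPhase (-(v / w))))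
      - Real.exp (-(w ^ 2 * gammaPhase (v / w)))) := by
  have := gammaPhase_neg_le (u := v / w) (by positivity)
  refine mul_nonneg hw.le (sub_nonneg.2 ?_)
  gcongr

lemma exp_gammaPhase_diff_le {w v : ℝ} (hw : 1 ≤ w) (hv : 0 ≤ v) :
    w * (Real.exp (-(w ^ 2 * gammaPhase (-(v / w)))) - Real.exp (-(w ^ 2 * gammaPhase (v / w))))
      ≤ (v + v ^ 3) * (Real.exp (1 / 4) * Real.exp (-(1 / 4) * v)) := by
  have hw0 : 0 < w := by linarith
  have hE := exp_neg_sq_mul_gammaPhase_neg_le hw hv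
  suffices h : w * (Real.exp (-(w ^ 2 * gammaPhase (-(v / w))))
      - Real.exp (-(w ^ 2 * gammaPhase (v / w))))
      ≤ (v + v ^ 3) * Real.exp (-(w ^ 2 * gammaPhase (-(v / w)))) from
    h.trans (by gcongr)
  have hu0 : 0 ≤ v / w := by positivity
  rcases le_total (v / w) 1 with h | h
  · have h1 := (abs_le.1 (abs_gammaPhase_odd_sub_le hu0 h)).1
    have h2 : gammaPhase (v / w) - gammaPhase (-(v / w)) ≤ (v / w) ^ 3 := by
      nlinarith [pow_le_pow_of_le_one hu0 h (show 3 ≤ 5 by norm_num), pow_nonneg hu0 3]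
    have h3 := exp_neg_sub_exp_neg_le (w ^ 2 * gammaPhase (-(v / w))) (w ^ 2 * gammaPhase (v / w))
    have h4 : w * (w ^ 2 * gammaPhase (v / w) - w ^ 2 * gammaPhase (-(v / w))) ≤ v + v ^ 3 := by
      have h5 := mul_le_mul_of_nonneg_left h2 (pow_nonneg hw0.le 3)
      have h6 : w ^ 3 * (v / w) ^ 3 = v ^ 3 := by field_simp
      linarith
    calc _ ≤ w * ((w ^ 2 * gammaPhase (v / w) - w ^ 2 * gammaPhase (-(v / w)))
          * Real.exp (-(w ^ 2 * gammaPhase (-(v / w))))) := by gcongr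
      _ = (w * (w ^ 2 * gammaPhase (v / w) - w ^ 2 * gammaPhase (-(v / w))))
          * Real.exp (-(w ^ 2 * gammaPhase (-(v / w)))) := by ring
      _ ≤ _ := by gcongr
  · have hvw : w ≤ v := (one_le_div hw0).1 h
    have h1 := Real.exp_pos (-(w ^ 2 * gammaPhase (v / w)))
    calc _ ≤ w * Real.exp (-(w ^ 2 * gammaPhase (-(v / w)))) := by gcongr; linarith
      _ ≤ _ := by gcongr; linarith [pow_nonneg hv 3]

lemma tendsto_sq_mul_gammaPhase (v : ℝ) :
    Tendsto (fun w : ℝ => w ^ 2 * gammaPhase (v / w)) atTop (nhds (v ^ 2 / 2)) := by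
  rw [tendsto_iff_norm_sub_tendsto_zero]
  have h0 : Tendsto (fun w : ℝ => |v| ^ 3 * (2 / 9) / w) atTop (nhds 0) :=
    tendsto_const_nhds.div_atTop tendsto_id
  refine squeeze_zero' (Eventually.of_forall fun _ => norm_nonneg _) ?_ h0
  filter_upwards [eventually_ge_atTop |v|, eventually_gt_atTop 0] with w hw hw0
  have h := abs_gammaPhase_sub_le (u := v / w)
    (by rw [abs_div, abs_of_pos hw0]; exact (div_le_one hw0).2 hw)
  have h2 : w ^ 2 * gammaPhase (v / w) - v ^ 2 / 2
      = w ^ 2 * (gammaPhase (v / w) - (v / w) ^ 2 / 2) := by field_simp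
  rw [Real.norm_eq_abs, h2, abs_mul, abs_of_pos (pow_pos hw0 2)]
  calc _ ≤ w ^ 2 * (|v / w| ^ 3 * (2 / 9)) := by gcongr
    _ = _ := by rw [abs_div, abs_of_pos hw0]; field_simp

lemma tendsto_cube_mul_gammaPhase_diff {v : ℝ} (hv : 0 ≤ v) :
    Tendsto (fun w : ℝ => w * (w ^ 2 * gammaPhase (v / w) - w ^ 2 * gammaPhase (-(v / w)))) atTop
      (nhds (v ^ 3 / 3)) := by
  rw [tendsto_iff_norm_sub_tendsto_zero]
  have h0 : Tendsto (fun w : ℝ => v ^ 5 / 50 / w ^ 2) atTop (nhds 0) :=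
    tendsto_const_nhds.div_atTop (tendsto_pow_atTop (by norm_num))
  refine squeeze_zero' (Eventually.of_forall fun _ => norm_nonneg _) ?_ h0
  filter_upwards [eventually_ge_atTop v, eventually_gt_atTop 0] with w hw hw0
  have h := abs_gammaPhase_odd_sub_le (u := v / w) (by positivity) ((div_le_one hw0).2 hw)
  have h2 : w * (w ^ 2 * gammaPhase (v / w) - w ^ 2 * gammaPhase (-(v / w))) - v ^ 3 / 3
      = -(w ^ 3 * (gammaPhase (-(v / w)) - gammaPhase (v / w) + (v / w) ^ 3 / 3)) := by
    field_simp; ring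
  rw [Real.norm_eq_abs, h2, abs_neg, abs_mul, abs_of_pos (pow_pos hw0 3)]
  calc _ ≤ w ^ 3 * ((v / w) ^ 5 / 50) := by gcongr
    _ = _ := by field_simp

lemma tendsto_exp_neg_sq_mul_gammaPhase (v : ℝ) :
    Tendsto (fun w : ℝ => Real.exp (-(w ^ 2 * gammaPhase (v / w)))) atTop
      (nhds (Real.exp (-(v ^ 2 / 2)))) :=
  (Real.continuous_exp.tendsto _).comp (tendsto_sq_mul_gammaPhase v).neg

lemma tendsto_exp_neg_sq_mul_gammaPhase_neg (v : ℝ) :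
    Tendsto (fun w : ℝ => Real.exp (-(w ^ 2 * gammaPhase (-(v / w))))) atTop
      (nhds (Real.exp (-(v ^ 2 / 2)))) := by
  simpa [neg_div] using tendsto_exp_neg_sq_mul_gammaPhase (-v)

lemma tendsto_exp_gammaPhase_diff {v : ℝ} (hv : 0 ≤ v) :
    Tendsto (fun w : ℝ => w * (Real.exp (-(w ^ 2 * gammaPhase (-(v / w))))
      - Real.exp (-(w ^ 2 * gammaPhase (v / w))))) atTop
      (nhds (v ^ 3 / 3 * Real.exp (-(v ^ 2 / 2)))) := by
  have hd := tendsto_cube_mul_gammaPhase_diff hv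
  refine tendsto_of_tendsto_of_tendsto_of_le_of_le'
    (hd.mul (tendsto_exp_neg_sq_mul_gammaPhase v))
    (hd.mul (tendsto_exp_neg_sq_mul_gammaPhase_neg v)) ?_ ?_
  · filter_upwards [eventually_gt_atTop 0] with w hw0
    rw [mul_assoc]
    gcongr
    exact mul_exp_neg_le_exp_neg_sub_exp_neg _ _
  · filter_upwards [eventually_gt_atTop 0] with w hw0
    rw [mul_assoc]
    gcongr
    exact exp_neg_sub_exp_neg_le _ _

lemma integrableOn_pow_mul_exp_neg_quarter (n : ℕ) :
    IntegrableOn (fun v : ℝ => v ^ n * (Real.exp (1 / 4) * Real.exp (-(1 / 4) * v)))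
      (Set.Ioi 0) := by
  have h := (integrableOn_rpow_mul_exp_neg_mul_rpow (p := 1) (s := n) (b := 1 / 4)
    (by have : (0 : ℝ) ≤ n := n.cast_nonneg
        linarith) (by norm_num) (by norm_num)).const_mul (Real.exp (1 / 4))
  refine h.congr (Eventually.of_forall fun v => ?_)
  simp only [Real.rpow_natCast, Real.rpow_one]
  ring

lemma integrableOn_exp_neg_quarter :
    IntegrableOn (fun v : ℝ => Real.exp (1 / 4) * Real.exp (-(1 / 4) * v)) (Set.Ioi 0) := by
  simpa using integrableOn_pow_mul_exp_neg_quarter 0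

lemma integrableOn_exp_neg_sq_mul_gammaPhase {w : ℝ} (hw : 1 ≤ w) :
    IntegrableOn (fun v : ℝ => Real.exp (-(w ^ 2 * gammaPhase (v / w)))) (Set.Ioi 0) := by
  refine integrableOn_exp_neg_quarter.mono' ?_ ?_
  · have := continuous_gammaPhase
    exact Continuous.aestronglyMeasurable (by fun_prop)
  · filter_upwards [ae_restrict_mem measurableSet_Ioi] with v hv
    rw [Real.norm_eq_abs, Real.abs_exp]
    exact exp_neg_sq_mul_gammaPhase_le hw (le_of_lt hv)

lemma integrableOn_exp_neg_sq_mul_gammaPhase_neg {w : ℝ} (hw : 1 ≤ w) :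
    IntegrableOn (fun v : ℝ => Real.exp (-(w ^ 2 * gammaPhase (-(v / w))))) (Set.Ioi 0) := by
  refine integrableOn_exp_neg_quarter.mono' ?_ ?_
  · have := continuous_gammaPhase
    exact Continuous.aestronglyMeasurable (by fun_prop)
  · filter_upwards [ae_restrict_mem measurableSet_Ioi] with v hv
    rw [Real.norm_eq_abs, Real.abs_exp]
    exact exp_neg_sq_mul_gammaPhase_neg_le hw (le_of_lt hv)

lemma integral_exp_neg_sq_div_two :
    ∫ v in Set.Ioi (0 : ℝ), Real.exp (-(v ^ 2 / 2)) = √(2 * π) / 2 := by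
  have h := integral_gaussian_Ioi (1 / 2)
  rw [show π / (1 / 2) = 2 * π by ring] at h
  rw [← h]
  congr 1 with v
  ring_nf

lemma integral_cube_mul_exp_neg_sq_div_two :
    ∫ v in Set.Ioi (0 : ℝ), v ^ 3 / 3 * Real.exp (-(v ^ 2 / 2)) = 2 / 3 := by
  have h := integral_rpow_mul_exp_neg_mul_rpow (p := 2) (q := 3) (b := 1 / 2)
    (by norm_num) (by norm_num) (by norm_num)
  have h2 : ∫ v in Set.Ioi (0 : ℝ), v ^ 3 / 3 * Real.exp (-(v ^ 2 / 2))
      = (1 / 3) * ∫ v in Set.Ioi (0 : ℝ), v ^ (3 : ℝ) * Real.exp (-(1 / 2) * v ^ (2 : ℝ)) := by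
    rw [← integral_const_mul]
    congr 1 with v
    norm_cast
    ring_nf
  rw [h2, h, show ((3 : ℝ) + 1) / 2 = 2 by norm_num, Real.Gamma_two,
    show -((3 : ℝ) + 1) / 2 = ((-2 : ℤ) : ℝ) by norm_num, Real.rpow_intCast]
  norm_num

lemma tendsto_integral_exp_neg_gammaPhase :
    Tendsto (fun w : ℝ => ∫ v in Set.Ioi (0 : ℝ), Real.exp (-(w ^ 2 * gammaPhase (v / w)))) atTop
      (nhds (√(2 * π) / 2)) := by
  rw [← integral_exp_neg_sq_div_two]
  refine tendsto_integral_filter_of_dominated_convergence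
    (fun v => Real.exp (1 / 4) * Real.exp (-(1 / 4) * v)) ?_ ?_ integrableOn_exp_neg_quarter
    (Eventually.of_forall fun v => tendsto_exp_neg_sq_mul_gammaPhase v)
  · filter_upwards [eventually_ge_atTop 1] with w hw
    exact (integrableOn_exp_neg_sq_mul_gammaPhase hw).aestronglyMeasurable
  · filter_upwards [eventually_ge_atTop 1] with w hw
    filter_upwards [ae_restrict_mem measurableSet_Ioi] with v hv
    rw [Real.norm_eq_abs, Real.abs_exp]
    exact exp_neg_sq_mul_gammaPhase_le hw (le_of_lt hv)

lemma tendsto_integral_exp_gammaPhase_diff :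
    Tendsto (fun w : ℝ => w * ((∫ v in Set.Ioi (0 : ℝ), Real.exp (-(w ^ 2 * gammaPhase (-(v / w)))))
      - ∫ v in Set.Ioi (0 : ℝ), Real.exp (-(w ^ 2 * gammaPhase (v / w))))) atTop
      (nhds (2 / 3)) := by
  have key : Tendsto (fun w : ℝ => ∫ v in Set.Ioi (0 : ℝ),
      w * (Real.exp (-(w ^ 2 * gammaPhase (-(v / w))))
        - Real.exp (-(w ^ 2 * gammaPhase (v / w))))) atTop (nhds (2 / 3)) := by
    rw [← integral_cube_mul_exp_neg_sq_div_two]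
    refine tendsto_integral_filter_of_dominated_convergence
      (fun v => (v + v ^ 3) * (Real.exp (1 / 4) * Real.exp (-(1 / 4) * v))) ?_ ?_ ?_ ?_
    · filter_upwards [eventually_ge_atTop 1] with w hw
      exact (((integrableOn_exp_neg_sq_mul_gammaPhase_neg hw).sub
        (integrableOn_exp_neg_sq_mul_gammaPhase hw)).const_mul w).aestronglyMeasurable
    · filter_upwards [eventually_ge_atTop 1] with w hw
      filter_upwards [ae_restrict_mem measurableSet_Ioi] with v hv
      rw [Real.norm_eq_abs, abs_of_nonneg
        (exp_gammaPhase_diff_nonneg (by linarith) (le_of_lt hv))]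
      exact exp_gammaPhase_diff_le hw (le_of_lt hv)
    · refine ((integrableOn_pow_mul_exp_neg_quarter 1).add
        (integrableOn_pow_mul_exp_neg_quarter 3)).congr (Eventually.of_forall fun v => ?_)
      simp only [Pi.add_apply]
      ring
    · filter_upwards [ae_restrict_mem measurableSet_Ioi] with v hv
      exact tendsto_exp_gammaPhase_diff (le_of_lt hv)
  refine key.congr' ?_
  filter_upwards [eventually_ge_atTop 1] with w hw
  rw [integral_const_mul, integral_sub (integrableOn_exp_neg_sq_mul_gammaPhase_neg hw)
    (integrableOn_exp_neg_sq_mul_gammaPhase hw)]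

lemma image_mul_exp_div {w : ℝ} (hw : 0 < w) :
    (fun v : ℝ => w ^ 2 * Real.exp (v / w)) '' Set.Ioi 0 = Set.Ioi (w ^ 2) := by
  ext t
  simp only [Set.mem_image, Set.mem_Ioi]
  constructor
  · rintro ⟨v, hv, rfl⟩
    have : 1 < Real.exp (v / w) := Real.one_lt_exp_iff.2 (by positivity)
    nlinarith [pow_pos hw 2]
  · intro ht
    have h1 : 1 < t / w ^ 2 := (one_lt_div (by positivity)).2 ht
    refine ⟨w * Real.log (t / w ^ 2), mul_pos hw (Real.log_pos h1), ?_⟩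
    rw [mul_div_cancel_left₀ _ hw.ne', Real.exp_log (by linarith)]
    field_simp

lemma image_mul_exp_neg_div {w : ℝ} (hw : 0 < w) :
    (fun v : ℝ => w ^ 2 * Real.exp (-(v / w))) '' Set.Ioi 0 = Set.Ioo 0 (w ^ 2) := by
  ext t
  simp only [Set.mem_image, Set.mem_Ioi, Set.mem_Ioo]
  constructor
  · rintro ⟨v, hv, rfl⟩
    have : Real.exp (-(v / w)) < 1 := Real.exp_lt_one_iff.2 (neg_lt_zero.2 (by positivity))
    exact ⟨by positivity, by nlinarith [pow_pos hw 2]⟩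
  · rintro ⟨ht0, ht⟩
    have h1 : t / w ^ 2 < 1 := (div_lt_one (by positivity)).2 ht
    have h0 : 0 < t / w ^ 2 := by positivity
    refine ⟨-(w * Real.log (t / w ^ 2)), neg_pos.2 (mul_neg_of_pos_of_neg hw
      (Real.log_neg h0 h1)), ?_⟩
    rw [neg_div, neg_neg, mul_div_cancel_left₀ _ hw.ne', Real.exp_log h0]
    field_simp

lemma gamma_integrand_mul_exp {w : ℝ} (hw : 0 < w) (u : ℝ) :
    w * Real.exp u * ((w ^ 2 * Real.exp u) ^ (w ^ 2 - 1) * Real.exp (-(w ^ 2 * Real.exp u)))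
      = w * (w ^ 2) ^ (w ^ 2 - 1) * Real.exp (-w ^ 2) * Real.exp (-(w ^ 2 * gammaPhase u)) := by
  rw [Real.mul_rpow (by positivity) (Real.exp_pos u).le, ← Real.exp_mul]
  have : Real.exp u * Real.exp (u * (w ^ 2 - 1)) * Real.exp (-(w ^ 2 * Real.exp u))
      = Real.exp (-w ^ 2) * Real.exp (-(w ^ 2 * gammaPhase u)) := by
    rw [← Real.exp_add, ← Real.exp_add, ← Real.exp_add]
    congr 1
    unfold gammaPhase
    ring
  linear_combination w * (w ^ 2) ^ (w ^ 2 - 1) * this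

lemma upperGamma_sq_self {w : ℝ} (hw : 0 < w) :
    upperGamma (w ^ 2) (w ^ 2) = w * (w ^ 2) ^ (w ^ 2 - 1) * Real.exp (-w ^ 2) *
      ∫ v in Set.Ioi (0 : ℝ), Real.exp (-(w ^ 2 * gammaPhase (v / w))) := by
  unfold upperGamma
  rw [← image_mul_exp_div hw, integral_image_eq_integral_abs_deriv_smul
    (f' := fun v => w * Real.exp (v / w)) measurableSet_Ioi, ← integral_const_mul]
  · congr 1 with v
    rw [abs_of_pos (by positivity), smul_eq_mul, gamma_integrand_mul_exp hw]
  · intro v _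
    refine HasDerivAt.hasDerivWithinAt ?_
    refine (((hasDerivAt_id' v).div_const w).exp.const_mul (w ^ 2)).congr_deriv ?_
    field_simp
  · intro a _ b _ hab
    have h := Real.exp_injective (mul_left_cancel₀ (pow_pos hw 2).ne' hab)
    exact (div_left_inj' hw.ne').1 h

lemma integral_Ioo_gamma_sq {w : ℝ} (hw : 0 < w) :
    ∫ t in Set.Ioo 0 (w ^ 2), t ^ (w ^ 2 - 1) * Real.exp (-t)
      = w * (w ^ 2) ^ (w ^ 2 - 1) * Real.exp (-w ^ 2) *
      ∫ v in Set.Ioi (0 : ℝ), Real.exp (-(w ^ 2 * gammaPhase (-(v / w)))) := by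
  rw [← image_mul_exp_neg_div hw, integral_image_eq_integral_abs_deriv_smul
    (f' := fun v => -(w * Real.exp (-(v / w)))) measurableSet_Ioi, ← integral_const_mul]
  · congr 1 with v
    rw [abs_neg, abs_of_pos (by positivity), smul_eq_mul, gamma_integrand_mul_exp hw]
  · intro v _
    refine HasDerivAt.hasDerivWithinAt ?_
    refine (((hasDerivAt_id' v).div_const w).neg.exp.const_mul (w ^ 2)).congr_deriv ?_
    simp only [Pi.neg_apply]
    field_simp
  · intro a _ b _ hab
    have h := Real.exp_injective (mul_left_cancel₀ (pow_pos hw 2).ne' hab)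
    exact (div_left_inj' hw.ne').1 (neg_injective h)

lemma Gamma_eq_integral_Ioo_add_upperGamma {z x : ℝ} (hz : 0 < z) (hx : 0 ≤ x) :
    Real.Gamma z = (∫ t in Set.Ioo 0 x, t ^ (z - 1) * Real.exp (-t)) + upperGamma z x := by
  have hi : IntegrableOn (fun t : ℝ => t ^ (z - 1) * Real.exp (-t)) (Set.Ioi 0) := by
    simpa only [mul_comm] using Real.GammaIntegral_convergent hz
  rw [Real.Gamma_eq_integral hz, ← integral_Ioc_eq_integral_Ioo, upperGamma,
    ← setIntegral_union (Set.Ioc_disjoint_Ioi le_rfl) measurableSet_Ioi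
      (hi.mono_set Set.Ioc_subset_Ioi_self) (hi.mono_set (Set.Ioi_subset_Ioi hx)),
    Set.Ioc_union_Ioi_eq_Ioi hx]
  simp only [mul_comm]

lemma regGammaQ_sq_self {w : ℝ} (hw : 0 < w) :
    regGammaQ (w ^ 2) (w ^ 2)
      = (∫ v in Set.Ioi (0 : ℝ), Real.exp (-(w ^ 2 * gammaPhase (v / w))))
        / ((∫ v in Set.Ioi (0 : ℝ), Real.exp (-(w ^ 2 * gammaPhase (-(v / w)))))
          + ∫ v in Set.Ioi (0 : ℝ), Real.exp (-(w ^ 2 * gammaPhase (v / w)))) := by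
  rw [regGammaQ, Gamma_eq_integral_Ioo_add_upperGamma (pow_pos hw 2) (sq_nonneg w),
    integral_Ioo_gamma_sq hw, upperGamma_sq_self hw, ← mul_add, mul_div_mul_left]
  positivity

lemma tendsto_half_sub_regGammaQ_sq :
    Tendsto (fun w : ℝ => (1 / 2 - regGammaQ (w ^ 2) (w ^ 2)) * (3 * √(2 * π * w ^ 2)))
      atTop (nhds 1) := by
  set A : ℝ → ℝ := fun w => ∫ v in Set.Ioi (0 : ℝ), Real.exp (-(w ^ 2 * gammaPhase (v / w)))
  set B : ℝ → ℝ := fun w => ∫ v in Set.Ioi (0 : ℝ), Real.exp (-(w ^ 2 * gammaPhase (-(v / w))))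
  have hA : Tendsto A atTop (nhds (√(2 * π) / 2)) := tendsto_integral_exp_neg_gammaPhase
  have hD : Tendsto (fun w => w * (B w - A w)) atTop (nhds (2 / 3)) :=
    tendsto_integral_exp_gammaPhase_diff
  have hpi : 0 < √(2 * π) := by positivity
  have hBA : Tendsto (fun w => B w - A w) atTop (nhds 0) := by
    refine (hD.div_atTop tendsto_id).congr' ?_
    filter_upwards [eventually_gt_atTop 0] with w hw
    exact mul_div_cancel_left₀ _ hw.ne'
  have hS : Tendsto (fun w => B w + A w) atTop (nhds √(2 * π)) := by
    convert hBA.add (hA.const_mul 2) using 2 <;> ring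
  have hlim := (hD.mul_const (3 * √(2 * π))).div (hS.const_mul 2) (by positivity)
  rw [show 2 / 3 * (3 * √(2 * π)) / (2 * √(2 * π)) = 1 by field_simp] at hlim
  refine hlim.congr' ?_
  filter_upwards [eventually_gt_atTop 0, hS.eventually_ne hpi.ne'] with w hw hne
  rw [regGammaQ_sq_self hw, Real.sqrt_mul (show 0 ≤ 2 * π by positivity) (w ^ 2),
    Real.sqrt_sq hw.le]
  change w * (B w - A w) * (3 * √(2 * π)) / (2 * (B w + A w))
    = (1 / 2 - A w / (B w + A w)) * (3 * (√(2 * π) * w))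
  field_simp
  ring

theorem stmt9 :
    Tendsto (fun z : ℝ => (1/2 - regGammaQ z z) * (3 * Real.sqrt (2 * π * z)))
      atTop (nhds 1)
    ∧ Tendsto (fun z : ℝ => regGammaQ z z) atTop (nhds (1/2)) := by
  have h1 : Tendsto (fun z : ℝ => (1/2 - regGammaQ z z) * (3 * Real.sqrt (2 * π * z)))
      atTop (nhds 1) := by
    refine (tendsto_half_sub_regGammaQ_sq.comp Real.tendsto_sqrt_atTop).congr' ?_
    filter_upwards [eventually_ge_atTop 0] with z hz
    simp only [Function.comp_apply, Real.sq_sqrt hz]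
  refine ⟨h1, ?_⟩
  have hs : Tendsto (fun z : ℝ => 3 * Real.sqrt (2 * π * z)) atTop atTop :=
    (Real.tendsto_sqrt_atTop.comp
      (tendsto_id.const_mul_atTop (by positivity))).const_mul_atTop (by norm_num)
  have h2 := (h1.div_atTop hs).const_sub (1 / 2)
  rw [sub_zero] at h2
  refine h2.congr' ?_
  filter_upwards [hs.eventually_gt_atTop 0] with z hz
  rw [mul_div_cancel_right₀ _ hz.ne']
  ring
end

section
/- For fixed 0 < λ < 1, as z → +∞: 1 - Q(z, λz) ~ (1/(1-λ)) · (1/√(2πz)) · e^{-z(λ - 1 - log λ)}, where Q(z,x) = Γ(z,x)/Γ(z). -/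
open Filter Real MeasureTheory

/-- The logarithm of the ratio of `Real.Gamma` to its Stirling approximation. -/
noncomputable def stirlingLogRemainder (z : ℝ) : ℝ :=
  log (Gamma z) - (z - 1 / 2) * log z + z - log (2 * π) / 2

theorem tendsto_stirlingLogRemainder_natCast :
    Tendsto (fun n : ℕ => stirlingLogRemainder n) atTop (nhds 0) := by
  have h : Tendsto (fun n : ℕ => log (Stirling.stirlingSeq n) - log (√π)) atTop (nhds 0) := by
    have := (Stirling.tendsto_stirlingSeq_sqrt_pi.log (by positivity)).sub_const (log (√π))
    simpa using this
  refine h.congr' ?_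
  filter_upwards [eventually_ge_atTop 1] with n hn
  have hn0 : (0 : ℝ) < n := by exact_mod_cast hn
  have hG : log (n.factorial : ℝ) = log n + log (Gamma n) := by
    rw [← Gamma_nat_eq_factorial, Gamma_add_one hn0.ne', log_mul hn0.ne' (Gamma_pos_of_pos hn0).ne']
  rw [Stirling.log_stirlingSeq_formula, hG, stirlingLogRemainder, log_sqrt pi_pos.le,
    log_mul two_ne_zero hn0.ne', log_mul two_ne_zero pi_pos.ne', log_div hn0.ne' (exp_ne_zero _),
    log_exp]
  ring

theorem abs_stirlingLogRemainder_add_sub_le {n : ℕ} (hn : 2 ≤ n) {s : ℝ} (hs : 0 ≤ s)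
    (hs1 : s ≤ 1) :
    |stirlingLogRemainder (n + s) - stirlingLogRemainder n| ≤ 2 / ((n : ℝ) - 1) := by
  have hn2 : (2 : ℝ) ≤ n := by exact_mod_cast hn
  rcases hs.eq_or_lt with rfl | hs
  · simp only [add_zero, sub_self, abs_zero]
    exact div_nonneg zero_le_two (by linarith)
  have hfeq : ∀ {y : ℝ}, 0 < y → (log ∘ Gamma) (y + 1) = (log ∘ Gamma) y + log y := by
    intro y hy
    simp only [Function.comp_apply]
    rw [Gamma_add_one hy.ne', log_mul hy.ne' (Gamma_pos_of_pos hy).ne', add_comm]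
  have hle := BohrMollerup.f_add_nat_le convexOn_log_Gamma hfeq (show n ≠ 0 by omega) hs hs1
  have hge := BohrMollerup.f_add_nat_ge convexOn_log_Gamma hfeq hn hs
  simp only [Function.comp_apply] at hle hge
  have hn0 : (0 : ℝ) < n := by linarith
  have hn1 : (0 : ℝ) < (n : ℝ) - 1 := by linarith
  have hz0 : (0 : ℝ) < n + s := by linarith
  have h1 := log_le_sub_one_of_pos (div_pos hz0 hn0)
  have h2 := one_sub_inv_le_log_of_pos (div_pos hz0 hn0)
  have h3 := one_sub_inv_le_log_of_pos (div_pos hn1 hn0)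
  rw [log_div hz0.ne' hn0.ne'] at h1 h2
  rw [log_div hn1.ne' hn0.ne'] at h3
  have hc : (0 : ℝ) ≤ n + s - 1 / 2 := by linarith
  have h1' := mul_le_mul_of_nonneg_left h1 hc
  have h2' := mul_le_mul_of_nonneg_left h2 hc
  have h3' := mul_le_mul_of_nonneg_left h3 hs.le
  have e1 : ((n : ℝ) + s - 1 / 2) * ((n + s) / n - 1) = s + s * (s - 1 / 2) / n := by
    field_simp; ring
  have e2 : ((n : ℝ) + s - 1 / 2) * (1 - ((n + s) / n)⁻¹) = s - s / 2 / (n + s) := by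
    field_simp; ring
  have e3 : s * (1 - (((n : ℝ) - 1) / n)⁻¹) = - (s / (n - 1)) := by
    field_simp; ring
  rw [e1] at h1'
  rw [e2] at h2'
  rw [e3] at h3'
  have b1 : s * (s - 1 / 2) / n ≤ 1 / ((n : ℝ) - 1) :=
    div_le_div₀ zero_le_one (by nlinarith) hn1 (by linarith)
  have b2 : s / 2 / (n + s) ≤ 1 / ((n : ℝ) - 1) :=
    div_le_div₀ zero_le_one (by linarith) hn1 (by linarith)
  have b3 : s / ((n : ℝ) - 1) ≤ 1 / ((n : ℝ) - 1) :=
    div_le_div₀ zero_le_one hs1 hn1 le_rfl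
  have b4 : 0 ≤ 1 / ((n : ℝ) - 1) := by positivity
  have b5 : 2 / ((n : ℝ) - 1) = 1 / ((n : ℝ) - 1) + 1 / ((n : ℝ) - 1) := by ring
  rw [b5, abs_le]
  unfold stirlingLogRemainder
  constructor <;> nlinarith

/-- **Stirling's formula** for the Gamma function on the positive reals. -/
theorem tendsto_stirlingLogRemainder : Tendsto stirlingLogRemainder atTop (nhds 0) := by
  have hfl : Tendsto (fun z : ℝ => ⌊z⌋₊) atTop atTop := tendsto_nat_floor_atTop
  have h1 : Tendsto (fun z : ℝ => stirlingLogRemainder (⌊z⌋₊ : ℝ)) atTop (nhds 0) :=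
    tendsto_stirlingLogRemainder_natCast.comp hfl
  have h2 : Tendsto (fun z : ℝ => 2 / ((⌊z⌋₊ : ℝ) - 1)) atTop (nhds 0) := by
    refine Tendsto.const_div_atTop ?_ 2
    exact tendsto_atTop_add_const_right _ (-1) (tendsto_natCast_atTop_atTop.comp hfl)
  have h3 : Tendsto (fun z : ℝ => stirlingLogRemainder z - stirlingLogRemainder (⌊z⌋₊ : ℝ))
      atTop (nhds 0) := by
    refine squeeze_zero_norm' ?_ h2
    filter_upwards [eventually_ge_atTop (2 : ℝ)] with z hz
    have hle := Nat.floor_le (show 0 ≤ z by linarith)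
    have hlt := Nat.lt_floor_add_one z
    have := abs_stirlingLogRemainder_add_sub_le (n := ⌊z⌋₊) (s := z - ⌊z⌋₊)
      (Nat.le_floor (by exact_mod_cast hz)) (by linarith) (by linarith)
    rwa [add_sub_cancel] at this
  simpa using h3.add h1

theorem integrableOn_rpow_mul_exp_neg {z : ℝ} (hz : 0 < z) :
    IntegrableOn (fun t : ℝ => t ^ (z - 1) * exp (-t)) (Set.Ioi 0) := by
  simpa only [mul_comm] using GammaIntegral_convergent hz

theorem one_sub_regGammaQ {z x : ℝ} (hz : 0 < z) (hx : 0 ≤ x) :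
    1 - regGammaQ z x = (∫ t in (0 : ℝ)..x, t ^ (z - 1) * exp (-t)) / Gamma z := by
  have hi := integrableOn_rpow_mul_exp_neg hz
  have hG : Gamma z = ∫ t in Set.Ioi (0 : ℝ), t ^ (z - 1) * exp (-t) := by
    rw [Gamma_eq_integral hz]; simp only [mul_comm]
  have hadd := intervalIntegral.integral_interval_add_Ioi hi
    (hi.mono_set (Set.Ioi_subset_Ioi hx))
  rw [← hG] at hadd
  rw [regGammaQ, upperGamma, eq_div_iff (Gamma_pos_of_pos hz).ne', sub_mul,
    div_mul_cancel₀ _ (Gamma_pos_of_pos hz).ne', ← hadd]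
  ring

theorem hasDerivAt_rpow_mul_exp_neg_div {z t : ℝ} (hz : 1 < z) (htz : t < z) :
    HasDerivAt (fun t : ℝ => t ^ z * exp (-t) / (z - t))
      (t ^ (z - 1) * exp (-t) * (1 + t / (z - t) ^ 2)) t := by
  have hne : z - t ≠ 0 := by linarith
  have h1 := hasDerivAt_rpow_const (x := t) (p := z) (Or.inr hz.le)
  have h2 : HasDerivAt (fun t : ℝ => exp (-t)) (-exp (-t)) t := by
    simpa using (hasDerivAt_neg t).exp
  have h3 : HasDerivAt (fun t : ℝ => z - t) (-1) t := by
    simpa using (hasDerivAt_id t).const_sub z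
  refine ((h1.mul h2).div h3 hne).congr_deriv ?_
  have : t ^ z = t * t ^ (z - 1) := by
    rcases eq_or_ne t 0 with rfl | h0
    · rw [zero_rpow (by linarith), zero_mul]
    · rw [rpow_sub_one h0]; field_simp
  simp only [Pi.mul_apply, this]
  field_simp
  ring

theorem continuousOn_rpow_mul_exp_neg {z : ℝ} (hz : 1 < z) (s : Set ℝ) :
    ContinuousOn (fun t : ℝ => t ^ (z - 1) * exp (-t)) s :=
  ((continuous_rpow_const (by linarith)).mul (by fun_prop)).continuousOn

theorem lowerGamma_bounds {lam z : ℝ} (h0 : 0 < lam) (h1 : lam < 1) (hz : 1 < z) :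
    (∫ t in (0 : ℝ)..(lam * z), t ^ (z - 1) * exp (-t)) ≤
        (lam * z) ^ z * exp (-(lam * z)) / (z - lam * z) ∧
      (lam * z) ^ z * exp (-(lam * z)) / (z - lam * z) ≤
        (1 + lam / (1 - lam) ^ 2 / z) * ∫ t in (0 : ℝ)..(lam * z), t ^ (z - 1) * exp (-t) := by
  have hz0 : 0 < z := by linarith
  have hx0 : 0 ≤ lam * z := by positivity
  have hxz : lam * z < z := by nlinarith
  have hlt : ∀ t ∈ Set.Icc 0 (lam * z), t < z := fun t ht => ht.2.trans_lt hxz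
  have hI : IntervalIntegrable (fun t : ℝ => t ^ (z - 1) * exp (-t)) volume 0 (lam * z) :=
    (continuousOn_rpow_mul_exp_neg hz _).intervalIntegrable
  have hc : ContinuousOn (fun t : ℝ => t ^ (z - 1) * exp (-t) * (1 + t / (z - t) ^ 2))
      (Set.uIcc 0 (lam * z)) := by
    rw [Set.uIcc_of_le hx0]
    refine (continuousOn_rpow_mul_exp_neg hz _).mul (continuousOn_const.add ?_)
    refine continuousOn_id.div (by fun_prop) fun t ht => ?_
    have := hlt t ht
    exact pow_ne_zero 2 (by linarith)
  have hFTC : (∫ t in (0 : ℝ)..(lam * z), t ^ (z - 1) * exp (-t) * (1 + t / (z - t) ^ 2)) =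
      (lam * z) ^ z * exp (-(lam * z)) / (z - lam * z) := by
    rw [intervalIntegral.integral_eq_sub_of_hasDerivAt
      (f := fun t : ℝ => t ^ z * exp (-t) / (z - t)) (fun t ht => ?_) hc.intervalIntegrable]
    · simp [zero_rpow hz0.ne']
    · rw [Set.uIcc_of_le hx0] at ht
      exact hasDerivAt_rpow_mul_exp_neg_div hz (hlt t ht)
  rw [← hFTC, ← intervalIntegral.integral_const_mul]
  constructor
  · refine intervalIntegral.integral_mono_on hx0 hI hc.intervalIntegrable fun t ht => ?_
    have ht0 := ht.1
    exact le_mul_of_one_le_right (by positivity) (le_add_of_nonneg_right (by positivity))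
  · refine intervalIntegral.integral_mono_on hx0 hc.intervalIntegrable (hI.const_mul _)
      fun t ht => ?_
    have ht0 := ht.1
    have h1' : 0 < 1 - lam := by linarith
    rw [mul_comm]
    refine mul_le_mul_of_nonneg_right ?_ (by positivity)
    have hb : t / (z - t) ^ 2 ≤ lam * z / (z - lam * z) ^ 2 := by
      have := ht.2
      have hp : 0 < z - lam * z := by linarith
      gcongr
    have he : lam * z / (z - lam * z) ^ 2 = lam / (1 - lam) ^ 2 / z := by
      rw [show z - lam * z = z * (1 - lam) by ring]
      field_simp
    linarith

theorem tendsto_lowerGamma_div {lam : ℝ} (h0 : 0 < lam) (h1 : lam < 1) :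
    Tendsto (fun z : ℝ => (∫ t in (0 : ℝ)..(lam * z), t ^ (z - 1) * exp (-t)) /
      ((lam * z) ^ z * exp (-(lam * z)) / (z - lam * z))) atTop (nhds 1) := by
  have hlow : Tendsto (fun z : ℝ => (1 + lam / (1 - lam) ^ 2 / z)⁻¹) atTop (nhds 1) := by
    have := (((tendsto_id (α := ℝ) (x := atTop)).const_div_atTop
      (lam / (1 - lam) ^ 2)).const_add 1).inv₀ (by norm_num)
    simpa using this
  refine tendsto_of_tendsto_of_tendsto_of_le_of_le' hlow tendsto_const_nhds ?_ ?_ <;>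
    filter_upwards [eventually_gt_atTop (1 : ℝ)] with z hz <;>
    obtain ⟨hu, hl⟩ := lowerGamma_bounds h0 h1 hz <;>
    have hz0 : 0 < z := by linarith
  all_goals
    have hp : 0 < z - lam * z := by nlinarith
    have hG : 0 < (lam * z) ^ z * exp (-(lam * z)) / (z - lam * z) := by positivity
  · have hd : 0 < 1 + lam / (1 - lam) ^ 2 / z := by positivity
    rw [le_div_iff₀ hG, inv_mul_le_iff₀ hd]
    exact hl
  · exact (div_le_one hG).2 hu

theorem Gamma_eq_exp_stirlingLogRemainder {z : ℝ} (hz : 0 < z) :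
    Gamma z =
      exp (stirlingLogRemainder z + (z - 1 / 2) * log z - z + log (2 * π) / 2) := by
  rw [stirlingLogRemainder]
  conv_lhs => rw [← exp_log (Gamma_pos_of_pos hz)]
  congr 1
  ring

theorem stmt10 (lam : ℝ) (h0 : 0 < lam) (h1 : lam < 1) :
    Tendsto (fun z : ℝ =>
        (1 - regGammaQ z (lam * z)) /
          ((1 / (1 - lam)) * (1 / Real.sqrt (2 * π * z)) *
            Real.exp (-z * (lam - 1 - Real.log lam))))
      atTop (nhds 1) := by
  have hlim := (tendsto_lowerGamma_div h0 h1).mul tendsto_stirlingLogRemainder.neg.rexp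
  rw [neg_zero, exp_zero, mul_one] at hlim
  refine hlim.congr' ?_
  filter_upwards [eventually_gt_atTop (0 : ℝ)] with z hz
  have h1' : 0 < 1 - lam := by linarith
  have hpow : (lam * z) ^ z = exp ((log lam + log z) * z) := by
    rw [rpow_def_of_pos (by positivity), log_mul h0.ne' hz.ne']
  have hsqrt : √(2 * π * z) = exp ((log (2 * π) + log z) / 2) := by
    rw [← log_mul (by positivity) hz.ne', ← log_sqrt (by positivity), exp_log (by positivity)]
  have hzexp : z - lam * z = exp (log z) * (1 - lam) := by rw [exp_log hz]; ring
  rw [one_sub_regGammaQ hz (by positivity), Gamma_eq_exp_stirlingLogRemainder hz, hpow, hsqrt,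
    hzexp]
  generalize (∫ t in (0 : ℝ)..(lam * z), t ^ (z - 1) * exp (-t)) = I
  have key : exp (stirlingLogRemainder z + (z - 1 / 2) * log z - z + log (2 * π) / 2) *
      exp (-z * (lam - 1 - log lam)) * exp (log z) * exp (-stirlingLogRemainder z) =
      exp ((log lam + log z) * z) * exp (-(lam * z)) * exp ((log (2 * π) + log z) / 2) := by
    simp only [← exp_add]
    congr 1
    ring
  rw [one_div_mul_one_div, div_div, div_mul_eq_mul_div, div_mul_eq_mul_div, one_mul,
    mul_div_assoc', div_div_eq_mul_div, div_div_eq_mul_div,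
    div_eq_div_iff (by positivity) (by positivity)]
  linear_combination I * (1 - lam) * key
end
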